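/- arXiv:2002.12915 — 7 statements merged into one kernel-verified Lean document; each statement's English description precedes it below -/
import Mathlib

section
/- Let c be a positive integer and for v ∈ ℝ^c let p(v) ∈ ℝ^c be the softmax vector p(v)_j = exp(v_j)/Σ_{k=1}^c exp(v_k). Define T : ℝ^c → ℝ by T(v) = Σ_{i=1}^c p(v)_i (1 − p(v)_i), which equals the trace of the Hessian of the cross-entropy loss ℓ^ce_y at v (for any label y). Then for all v ∈ ℝ^c, ‖∇T(v)‖₂ ≤ √2 · T(v). -/
/-- The softmax probability vector of `v ∈ ℝ^c`. -/
noncomputable def softmax {c : ℕ} (v : EuclideanSpace ℝ (Fin c)) (j : Fin c) : ℝ :=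
  Real.exp (v j) / ∑ k, Real.exp (v k)

/-- `T(v) = ∑ i p(v)_i (1 − p(v)_i)`, the trace of the Hessian of the cross-entropy
loss at `v`. -/
noncomputable def softmaxHessTrace {c : ℕ} (v : EuclideanSpace ℝ (Fin c)) : ℝ :=
  ∑ i, softmax v i * (1 - softmax v i)

theorem hasGradientAt_softmax {c : ℕ} (hc : 0 < c) (v : EuclideanSpace ℝ (Fin c)) (i : Fin c) :
    HasGradientAt (fun u => softmax u i)
      (softmax v i • (EuclideanSpace.single i 1 - WithLp.toLp 2 (softmax v))) v := by
  have : Nonempty (Fin c) := ⟨⟨0, hc⟩⟩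
  have hexp (k : Fin c) : HasFDerivAt (fun u : EuclideanSpace ℝ (Fin c) => Real.exp (u k))
      (Real.exp (v k) • EuclideanSpace.proj (𝕜 := ℝ) k) v :=
    (EuclideanSpace.proj (𝕜 := ℝ) k : EuclideanSpace ℝ (Fin c) →L[ℝ] ℝ).hasFDerivAt.exp
  have hZ : 0 < ∑ k, Real.exp (v k) :=
    Finset.sum_pos (fun k _ => Real.exp_pos _) Finset.univ_nonempty
  have hsum := HasFDerivAt.fun_sum (u := Finset.univ) fun k _ => hexp k
  rw [hasGradientAt_iff_hasFDerivAt]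
  have hsoftmax : (fun u : EuclideanSpace ℝ (Fin c) => softmax u i)
      = fun u => Real.exp (u i) * (∑ k, Real.exp (u k))⁻¹ :=
    funext fun u => div_eq_mul_inv _ _
  rw [hsoftmax]
  refine ((hexp i).fun_mul ((hasDerivAt_inv hZ.ne').comp_hasFDerivAt v hsum)).congr_fderiv ?_
  ext w
  have hw : ∑ k, w k * softmax v k
      = (∑ k, Real.exp (v k) * w k) / ∑ k, Real.exp (v k) := by
    rw [Finset.sum_div]
    exact Finset.sum_congr rfl fun k _ => by rw [softmax]; ring
  simp [PiLp.inner_apply, hw]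
  rw [softmax]
  field_simp
  ring

theorem softmax_nonneg {c : ℕ} (v : EuclideanSpace ℝ (Fin c)) (j : Fin c) : 0 ≤ softmax v j := by
  unfold softmax
  positivity

theorem sum_softmax {c : ℕ} (hc : 0 < c) (v : EuclideanSpace ℝ (Fin c)) :
    ∑ j, softmax v j = 1 := by
  have : Nonempty (Fin c) := ⟨⟨0, hc⟩⟩
  have hZ : 0 < ∑ k, Real.exp (v k) :=
    Finset.sum_pos (fun k _ => Real.exp_pos _) Finset.univ_nonempty
  simp only [softmax, ← Finset.sum_div]
  exact div_self hZ.ne'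

theorem softmax_le_one {c : ℕ} (hc : 0 < c) (v : EuclideanSpace ℝ (Fin c)) (j : Fin c) :
    softmax v j ≤ 1 :=
  sum_softmax hc v ▸
    Finset.single_le_sum (fun k _ => softmax_nonneg v k) (Finset.mem_univ j)

theorem hasGradientAt_softmaxHessTrace {c : ℕ} (hc : 0 < c) (v : EuclideanSpace ℝ (Fin c)) :
    HasGradientAt softmaxHessTrace
      (∑ i, ((1 - 2 * softmax v i) * softmax v i) •
        (EuclideanSpace.single i 1 - WithLp.toLp 2 (softmax v))) v := by
  rw [hasGradientAt_iff_hasFDerivAt]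
  have h (i : Fin c) := (hasGradientAt_softmax hc v i).hasFDerivAt
  refine (HasFDerivAt.fun_sum (u := Finset.univ) fun i _ =>
    (h i).fun_mul ((h i).const_sub 1)).congr_fderiv ?_
  rw [map_sum]
  refine Finset.sum_congr rfl fun i _ => ?_
  simp only [map_smul]
  module

/-- The distance from a vertex of the simplex to the softmax vector. -/
theorem norm_single_sub_softmax_le {c : ℕ} (hc : 0 < c) (v : EuclideanSpace ℝ (Fin c))
    (i : Fin c) :
    ‖EuclideanSpace.single i (1 : ℝ) - WithLp.toLp 2 (softmax v)‖
      ≤ Real.sqrt 2 * (1 - softmax v i) := by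
  have hi : 0 ≤ 1 - softmax v i := sub_nonneg.2 (softmax_le_one hc v i)
  have hrest : ∑ k ∈ Finset.univ.erase i, softmax v k = 1 - softmax v i := by
    rw [← sum_softmax hc v, ← Finset.add_sum_erase _ _ (Finset.mem_univ i)]
    ring
  have hsq : ∑ k ∈ Finset.univ.erase i, softmax v k ^ 2 ≤ (1 - softmax v i) ^ 2 := by
    rw [← hrest]
    exact Finset.sum_sq_le_sq_sum_of_nonneg fun k _ => softmax_nonneg v k
  have hcongr : ∑ k ∈ Finset.univ.erase i,
      ‖(EuclideanSpace.single i (1 : ℝ) - WithLp.toLp 2 (softmax v)) k‖ ^ 2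
        = ∑ k ∈ Finset.univ.erase i, softmax v k ^ 2 :=
    Finset.sum_congr rfl fun k hk => by simp [Finset.ne_of_mem_erase hk]
  refine le_of_sq_le_sq ?_ (by positivity)
  rw [EuclideanSpace.norm_sq_eq, ← Finset.add_sum_erase _ _ (Finset.mem_univ i), hcongr, mul_pow,
    Real.sq_sqrt zero_le_two]
  have hii : ‖(EuclideanSpace.single i (1 : ℝ) - WithLp.toLp 2 (softmax v)) i‖ ^ 2
      = (1 - softmax v i) ^ 2 := by simp
  linarith

/-- For all `v ∈ ℝ^c`, `‖∇T(v)‖₂ ≤ √2 · T(v)`. -/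
theorem norm_gradient_softmaxHessTrace_le (c : ℕ) (hc : 0 < c)
    (v : EuclideanSpace ℝ (Fin c)) :
    ‖gradient (softmaxHessTrace (c := c)) v‖ ≤ Real.sqrt 2 * softmaxHessTrace v := by
  rw [(hasGradientAt_softmaxHessTrace hc v).gradient, softmaxHessTrace, Finset.mul_sum]
  refine norm_sum_le_of_le _ fun i _ => ?_
  have h0 := softmax_nonneg v i
  have h1 := softmax_le_one hc v i
  have habs : |1 - 2 * softmax v i| ≤ 1 := abs_le.2 ⟨by linarith, by linarith⟩
  rw [norm_smul, Real.norm_eq_abs, abs_mul, abs_of_nonneg h0]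
  calc |1 - 2 * softmax v i| * softmax v i * _
      ≤ 1 * softmax v i * (Real.sqrt 2 * (1 - softmax v i)) := by
        gcongr
        exact norm_single_sub_softmax_le hc v i
    _ = Real.sqrt 2 * (softmax v i * (1 - softmax v i)) := by ring
end

section
/- There exists a universal constant C > 0 such that the following holds. Let n, c be positive integers with nc ≥ 2, and let α, A, B, τ, κ, μ, ν > 0. Define θ = log³(nc)·κ² and G(β) = β(1 + 1/α)μκ + (1 + 1/α)ν·(exp(τβκ) − τβκ − 1)/τ² + (1+α)·B·A²·log³(nc)/(β²n) for β > 0. Then inf_{β>0} G(β) ≤ C · [ (1 + 1/α)^{2/3}(1 + α)^{1/3}(θB)^{1/3}(Aμ)^{2/3}/n^{1/3} + A·√(ν(1+α)(1+1/α)θB)/√n + (1+α)·B·A²·θ·τ² / (n·(log²((1+α)·B·A²·θ·τ⁴/(n(1+1/α)ν)) + 1)) ]. -/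
/-- `exp x - x - 1` is at most `x ^ 2` on `[0, 1]`. -/
theorem exp_sub_sub_one_le_sq {x : ℝ} (h0 : 0 ≤ x) (h1 : x ≤ 1) :
    Real.exp x - x - 1 ≤ x ^ 2 := by
  have h := Real.abs_exp_sub_one_sub_id_le (x := x) (by rwa [abs_of_nonneg h0])
  linarith [le_abs_self (Real.exp x - 1 - x)]

/-- Replacing two positive numbers by their minimum in `Q / x ^ 2` costs at most the sum. -/
theorem div_min_sq_le_add {Q x y : ℝ} (hQ : 0 ≤ Q) :
    Q / (min x y) ^ 2 ≤ Q / x ^ 2 + Q / y ^ 2 := by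
  have hx : 0 ≤ Q / x ^ 2 := by positivity
  have hy : 0 ≤ Q / y ^ 2 := by positivity
  rcases min_choice x y with h | h <;> rw [h] <;> linarith

/-- Normalized form of the bound: `T` and `S` stand for `(P ^ 2 * Q) ^ (1 / 3)` and
`(V * Q) ^ (1 / 2)`. -/
theorem exists_linear_add_exp_add_inv_sq_le {P V Q T S : ℝ} (hP : 0 < P) (hV : 0 < V)
    (hQ : 0 < Q) (hT : 0 < T) (hS : 0 < S) (hTPQ : T ^ 3 = P ^ 2 * Q) (hSVQ : S ^ 2 = V * Q) :
    ∃ x > 0, P * x + V * (Real.exp x - x - 1) + Q / x ^ 2 ≤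
      4 * (T + S + Q / (Real.log (Q / V) ^ 2 + 1)) := by
  have hPT : P * (T / P) = T := by field_simp
  have hQT : Q / (T / P) ^ 2 = T := by
    field_simp
    linarith
  have hW : 0 ≤ Q / (Real.log (Q / V) ^ 2 + 1) := by positivity
  have key : ∀ y > 0, V * (Real.exp y - y - 1) ≤ 2 * S →
      Q / y ^ 2 ≤ S + 4 * (Q / (Real.log (Q / V) ^ 2 + 1)) →
      ∃ x > 0, P * x + V * (Real.exp x - x - 1) + Q / x ^ 2 ≤
        4 * (T + S + Q / (Real.log (Q / V) ^ 2 + 1)) := by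
    intro y hy hy1 hy2
    have hx : 0 < min (T / P) y := lt_min (by positivity) hy
    refine ⟨min (T / P) y, hx, ?_⟩
    have h1 : P * min (T / P) y ≤ T := by
      rw [← hPT]
      gcongr
      rw [hPT]
      exact min_le_left _ _
    have h2 : V * (Real.exp (min (T / P) y) - min (T / P) y - 1) ≤ 2 * S := by
      refine le_trans (mul_le_mul_of_nonneg_left ?_ hV.le) hy1
      have hxy := min_le_right (T / P) y
      set x := min (T / P) y
      have ha : Real.exp y = Real.exp x * Real.exp (y - x) := by
        rw [← Real.exp_add]
        congr 1
        ring
      have hb : y - x + 1 ≤ Real.exp (y - x) := Real.add_one_le_exp _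
      have hc : 1 ≤ Real.exp x := Real.one_le_exp hx.le
      nlinarith
    have h3 := div_min_sq_le_add (x := T / P) (y := y) hQ.le
    linarith
  rcases le_total Q V with h | h
  · have hSV : S ≤ V := by nlinarith
    have hsq : Real.sqrt (S / V) ^ 2 = S / V := Real.sq_sqrt (by positivity)
    have hVS : V * (S / V) = S := by field_simp
    refine key (Real.sqrt (S / V)) (by positivity) ?_ ?_
    · have := exp_sub_sub_one_le_sq (Real.sqrt_nonneg (S / V))
        (Real.sqrt_le_one.mpr ((div_le_one hV).mpr hSV))
      rw [hsq] at this
      have := mul_le_mul_of_nonneg_left this hV.le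
      linarith
    · have : Q / (S / V) = S := by
        field_simp
        linarith
      rw [hsq, this]
      linarith
  · have hlog : 0 ≤ Real.log (Q / V) := Real.log_nonneg ((one_le_div hV).mpr h)
    set l := Real.log (Q / V) with hl
    refine key (1 / 2 + l / 2) (by positivity) ?_ ?_
    · have h1 : Real.exp (l / 2) = S / V := by
        rw [← sq_eq_sq₀ (Real.exp_pos _).le (by positivity), ← Real.exp_nat_mul]
        have : ((2 : ℕ) : ℝ) * (l / 2) = l := by
          push_cast
          ring
        rw [this, hl, Real.exp_log (by positivity), div_pow, hSVQ]
        field_simp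
      have h2 : Real.exp (1 / 2) ≤ 2 := by
        have := exp_sub_sub_one_le_sq (x := 1 / 2) (by norm_num) (by norm_num)
        linarith
      have h3 : V * Real.exp (1 / 2 + l / 2) ≤ 2 * S := by
        rw [Real.exp_add, h1]
        calc V * (Real.exp (1 / 2) * (S / V)) = Real.exp (1 / 2) * S := by field_simp
          _ ≤ 2 * S := by gcongr
      nlinarith
    · have h1 : Q / (1 / 2 + l / 2) ^ 2 ≤ Q / ((l ^ 2 + 1) / 4) := by
        gcongr
        nlinarith
      have h2 : Q / ((l ^ 2 + 1) / 4) = 4 * (Q / (l ^ 2 + 1)) := by field_simp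
      linarith


/-- Bound on the infimum of
`G(β) = β(1+1/α)μκ + (1+1/α)ν(exp(τβκ) − τβκ − 1)/τ² + (1+α)BA² log³(nc)/(β²n)`. -/
theorem G_inf_upper_bound :
    ∃ C : ℝ, 0 < C ∧
      ∀ (n c : ℕ), 0 < n → 0 < c → 2 ≤ n * c →
      ∀ α A B τ κ μ ν : ℝ,
        0 < α → 0 < A → 0 < B → 0 < τ → 0 < κ → 0 < μ → 0 < ν →
        sInf {v : ℝ | ∃ β > (0 : ℝ), v =
            β * (1 + 1 / α) * μ * κ +
              (1 + 1 / α) * ν * (Real.exp (τ * β * κ) - τ * β * κ - 1) / τ ^ 2 +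
              (1 + α) * B * A ^ 2 * (Real.log (n * c)) ^ 3 / (β ^ 2 * n)} ≤
          C * ((1 + 1 / α) ^ ((2 : ℝ) / 3) * (1 + α) ^ ((1 : ℝ) / 3) *
                ((Real.log (n * c)) ^ 3 * κ ^ 2 * B) ^ ((1 : ℝ) / 3) *
                (A * μ) ^ ((2 : ℝ) / 3) / (n : ℝ) ^ ((1 : ℝ) / 3) +
              A * Real.sqrt (ν * (1 + α) * (1 + 1 / α) *
                ((Real.log (n * c)) ^ 3 * κ ^ 2) * B) / Real.sqrt n +
              (1 + α) * B * A ^ 2 * ((Real.log (n * c)) ^ 3 * κ ^ 2) * τ ^ 2 /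
                (n * ((Real.log ((1 + α) * B * A ^ 2 * ((Real.log (n * c)) ^ 3 * κ ^ 2) *
                    τ ^ 4 / (n * (1 + 1 / α) * ν))) ^ 2 + 1))) := by
  refine ⟨4, by norm_num, ?_⟩
  intro n c hn _ hnc α A B τ κ μ ν hα hA hB hτ hκ hμ hν
  have hn' : (0 : ℝ) < n := by exact_mod_cast hn
  have hlog : 0 < Real.log (n * c) := Real.log_pos (by exact_mod_cast hnc)
  obtain ⟨a, ha⟩ : ∃ a, a = 1 + 1 / α := ⟨_, rfl⟩
  obtain ⟨b, hb⟩ : ∃ b, b = 1 + α := ⟨_, rfl⟩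
  have ha0 : 0 < a := by
    rw [ha]
    positivity
  have hb0 : 0 < b := by
    rw [hb]
    positivity
  obtain ⟨L, hL⟩ : ∃ L, L = Real.log (n * c) ^ 3 := ⟨_, rfl⟩
  have hL0 : 0 < L := by
    rw [hL]
    positivity
  rw [← ha, ← hb, ← hL]
  have hthird : ∀ x : ℝ, 0 < x → (x ^ ((1 : ℝ) / 3)) ^ 3 = x := fun x hx => by
    rw [← Real.rpow_natCast, ← Real.rpow_mul hx.le]
    norm_num
  have htwo : ∀ x : ℝ, 0 < x → (x ^ ((2 : ℝ) / 3)) ^ 3 = x ^ 2 := fun x hx => by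
    rw [← Real.rpow_natCast, ← Real.rpow_mul hx.le]
    norm_num
  obtain ⟨x, hx, hle⟩ := exists_linear_add_exp_add_inv_sq_le
    (P := a * μ / τ) (V := a * ν / τ ^ 2) (Q := b * B * A ^ 2 * (L * κ ^ 2) * τ ^ 2 / n)
    (T := a ^ ((2 : ℝ) / 3) * b ^ ((1 : ℝ) / 3) * (L * κ ^ 2 * B) ^ ((1 : ℝ) / 3) *
      (A * μ) ^ ((2 : ℝ) / 3) / (n : ℝ) ^ ((1 : ℝ) / 3))
    (S := A * Real.sqrt (ν * b * a * (L * κ ^ 2) * B) / Real.sqrt n)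
    (by positivity) (by positivity) (by positivity) (by positivity) (by positivity)
    (by
      rw [div_pow, mul_pow, mul_pow, mul_pow, htwo a ha0, hthird b hb0,
        hthird _ (by positivity), htwo _ (by positivity), hthird _ hn']
      field_simp)
    (by
      rw [div_pow, mul_pow, Real.sq_sqrt (by positivity), Real.sq_sqrt hn'.le]
      field_simp)
  have hratio : b * B * A ^ 2 * (L * κ ^ 2) * τ ^ 2 / n / (a * ν / τ ^ 2) =
      b * B * A ^ 2 * (L * κ ^ 2) * τ ^ 4 / (n * a * ν) := by field_simp
  rw [hratio, div_div _ (n : ℝ) (_ + 1)] at hle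
  refine le_trans (csInf_le ⟨0, ?_⟩ ⟨x / (τ * κ), by positivity, rfl⟩) (le_trans (le_of_eq ?_) hle)
  · rintro v ⟨β, hβ, rfl⟩
    have := Real.add_one_le_exp (τ * β * κ)
    have : 0 ≤ Real.exp (τ * β * κ) - τ * β * κ - 1 := by linarith
    positivity
  · have : τ * (x / (τ * κ)) * κ = x := by field_simp
    rw [this]
    field_simp
end

section
/- Let c, d be positive integers and let ℓ : ℝ^c × {1,…,c} → ℝ be such that for each label y, ℓ(·,y) is nonnegative, convex, three times continuously differentiable, and satisfies ‖∇_h tr(∇²_h ℓ(h,y))‖₂ ≤ τ · tr(∇²_h ℓ(h,y)) for all h ∈ ℝ^c and some τ > 0. Then for every B > 0, σ > 0, W ∈ ℝ^{c×d}, x ∈ ℝ^d, and label y: ℓ̃_σ(W,x,y) ≤ ℓ(Wx,y) + ‖∇_v ℓ(v,y)|_{v=Wx}‖₂ · ‖x‖₂ · σ + tr(∇²_v ℓ(v,y)|_{v=Wx}) · (exp(σ·τ·‖x‖₂) − σ·τ·‖x‖₂ − 1)/τ². -/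
open MeasureTheory

/-- The quadratic ramp penalty truncated at `σ`. -/
noncomputable def sPen (σ t : ℝ) : ℝ := if t < σ then (1 - t / σ) ^ 2 else 0

/-- `W x` as a vector in Euclidean space. -/
noncomputable def mulVecE {c d : ℕ} (W : Matrix (Fin c) (Fin d) ℝ)
    (x : EuclideanSpace ℝ (Fin d)) : EuclideanSpace ℝ (Fin c) :=
  (WithLp.equiv 2 (Fin c → ℝ)).symm (W.mulVec ((WithLp.equiv 2 (Fin d → ℝ)) x))

/-- `‖Wᵀ‖_{2,1}`: the sum of the Euclidean norms of the rows of `W`. -/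
noncomputable def rowNormSum {c d : ℕ} (W : Matrix (Fin c) (Fin d) ℝ) : ℝ :=
  ∑ i, ‖((WithLp.equiv 2 (Fin d → ℝ)).symm (W i))‖

/-- The perturbed truncated loss
`ℓ̃_σ(W,x,y) = sup_δ s_σ(‖δ‖₂) · min{B, ℓ(Wx + ‖x‖₂ δ, y)}`. -/
noncomputable def ellTilde {c d : ℕ} (ℓ : EuclideanSpace ℝ (Fin c) → Fin c → ℝ) (B σ : ℝ)
    (W : Matrix (Fin c) (Fin d) ℝ) (x : EuclideanSpace ℝ (Fin d)) (y : Fin c) : ℝ :=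
  ⨆ δ : EuclideanSpace ℝ (Fin c), sPen σ ‖δ‖ * min B (ℓ (mulVecE W x + ‖x‖ • δ) y)

/-- The trace of the Hessian of `f` at `v`. -/
noncomputable def hessTrace {c : ℕ} (f : EuclideanSpace ℝ (Fin c) → ℝ)
    (v : EuclideanSpace ℝ (Fin c)) : ℝ :=
  ∑ i, iteratedFDeriv ℝ 2 f v ![EuclideanSpace.single i 1, EuclideanSpace.single i 1]

section LineRestriction

variable {E : Type*} [NormedAddCommGroup E] [NormedSpace ℝ E] {f : E → ℝ}

lemma hasDerivAt_comp_line {F : Type*} [NormedAddCommGroup F] [NormedSpace ℝ F] {g : E → F}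
    (hg : Differentiable ℝ g) (v u : E) (t : ℝ) :
    HasDerivAt (fun s : ℝ => g (v + s • u)) (fderiv ℝ g (v + t • u) u) t := by
  have hline : HasDerivAt (fun s : ℝ => v + s • u) u t := by
    simpa using ((hasDerivAt_id t).smul_const u).const_add v
  exact (hg (v + t • u)).hasFDerivAt.comp_hasDerivAt t hline

lemma hasDerivAt_fderiv_comp_line (hf : ContDiff ℝ 2 f) (v u : E) (t : ℝ) :
    HasDerivAt (fun s : ℝ => fderiv ℝ f (v + s • u) u)
      (fderiv ℝ (fderiv ℝ f) (v + t • u) u u) t := by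
  have hf' : ContDiff ℝ 1 (fderiv ℝ f) := hf.fderiv_right (by norm_num)
  simpa using (hasDerivAt_comp_line (hf'.differentiable (by norm_num)) v u t).clm_apply
    (hasDerivAt_const t u)

lemma ConvexOn.fderiv_fderiv_apply_self_nonneg (hconv : ConvexOn ℝ Set.univ f)
    (hf : ContDiff ℝ 2 f) (v u : E) : 0 ≤ fderiv ℝ (fderiv ℝ f) v u u := by
  have hline : ConvexOn ℝ Set.univ (fun t : ℝ => f (v + t • u)) := by
    have h := hconv.comp_affineMap (AffineMap.lineMap v (v + u) : ℝ →ᵃ[ℝ] E)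
    simpa [Function.comp_def, AffineMap.lineMap_apply, add_comm] using h
  have hderiv := hasDerivAt_comp_line (hf.differentiable (by norm_num)) v u
  have hmono : Monotone (fun t : ℝ => fderiv ℝ f (v + t • u) u) := by
    have h := hline.monotoneOn_deriv fun t _ => (hderiv t).differentiableAt
    rw [monotoneOn_univ] at h
    rwa [show deriv (fun t : ℝ => f (v + t • u)) = fun t => fderiv ℝ f (v + t • u) u from
      funext fun t => (hderiv t).deriv] at h
  have hsecond := (hasDerivAt_fderiv_comp_line hf v u 0).deriv
  rw [zero_smul, add_zero] at hsecond
  rw [← hsecond]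
  exact hmono.deriv_nonneg

end LineRestriction

section HessianTrace

variable {c : ℕ}

lemma apply_self_le_norm_sq_mul_sum
    (A : EuclideanSpace ℝ (Fin c) →L[ℝ] EuclideanSpace ℝ (Fin c) →L[ℝ] ℝ)
    (hA : ∀ u, 0 ≤ A u u) (u : EuclideanSpace ℝ (Fin c)) :
    A u u ≤ ‖u‖ ^ 2 * ∑ i, A (EuclideanSpace.single i 1) (EuclideanSpace.single i 1) := by
  set e : Fin c → EuclideanSpace ℝ (Fin c) := fun i => EuclideanSpace.single i 1 with he
  have hu : u = ∑ i, u i • e i := by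
    simpa [he] using ((EuclideanSpace.basisFun (Fin c) ℝ).sum_repr u).symm
  have hexpand : A u u = ∑ i, ∑ j, u i * u j * A (e i) (e j) := by
    conv_lhs => rw [hu]
    simp only [map_sum, map_smul, sum_apply, smul_apply,
      smul_eq_mul, Finset.mul_sum, mul_assoc]
    rw [Finset.sum_comm]
    refine Finset.sum_congr rfl fun i _ => Finset.sum_congr rfl fun j _ => ?_
    ring
  have hpair : ∀ i j, u i * u j * A (e i) (e j) + u j * u i * A (e j) (e i) ≤
      u i ^ 2 * A (e j) (e j) + u j ^ 2 * A (e i) (e i) := by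
    intro i j
    have h := hA (u i • e j - u j • e i)
    simp only [map_sub, map_smul, sub_apply, smul_apply,
      smul_eq_mul] at h
    linarith
  have hsum := Finset.sum_le_sum fun i (_ : i ∈ Finset.univ) =>
    Finset.sum_le_sum fun j (_ : j ∈ Finset.univ) => hpair i j
  simp only [Finset.sum_add_distrib] at hsum
  rw [Finset.sum_comm (f := fun i j => u j * u i * A (e j) (e i)),
    Finset.sum_comm (f := fun i j => u j ^ 2 * A (e i) (e i)), ← hexpand] at hsum
  rw [EuclideanSpace.real_norm_sq_eq, Finset.sum_mul_sum]
  linarith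

variable {f : EuclideanSpace ℝ (Fin c) → ℝ}

lemma hessTrace_eq_sum_fderiv (f : EuclideanSpace ℝ (Fin c) → ℝ) :
    hessTrace f = fun v => ∑ i, fderiv ℝ (fderiv ℝ f) v
      (EuclideanSpace.single i 1) (EuclideanSpace.single i 1) := by
  funext v
  simp [hessTrace, iteratedFDeriv_two_apply]

lemma fderiv_fderiv_apply_self_le (hconv : ConvexOn ℝ Set.univ f) (hf : ContDiff ℝ 2 f)
    (v u : EuclideanSpace ℝ (Fin c)) :
    fderiv ℝ (fderiv ℝ f) v u u ≤ ‖u‖ ^ 2 * hessTrace f v := by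
  rw [hessTrace_eq_sum_fderiv]
  exact apply_self_le_norm_sq_mul_sum _ (hconv.fderiv_fderiv_apply_self_nonneg hf v) u

lemma ConvexOn.hessTrace_nonneg (hconv : ConvexOn ℝ Set.univ f) (hf : ContDiff ℝ 2 f)
    (v : EuclideanSpace ℝ (Fin c)) : 0 ≤ hessTrace f v := by
  rw [hessTrace_eq_sum_fderiv]
  exact Finset.sum_nonneg fun i _ => hconv.fderiv_fderiv_apply_self_nonneg hf v _

lemma ContDiff.differentiable_hessTrace (hf : ContDiff ℝ 3 f) :
    Differentiable ℝ (hessTrace f) := by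
  have hf' : ContDiff ℝ 2 (fderiv ℝ f) := hf.fderiv_right (by norm_num)
  have hf'' : ContDiff ℝ 1 (fderiv ℝ (fderiv ℝ f)) := hf'.fderiv_right (by norm_num)
  have hd := hf''.differentiable (by norm_num)
  rw [hessTrace_eq_sum_fderiv]
  fun_prop

lemma fderiv_apply_le_norm_gradient_mul {E : Type*} [NormedAddCommGroup E]
    [InnerProductSpace ℝ E] [CompleteSpace E] (g : E → ℝ) (v u : E) :
    fderiv ℝ g v u ≤ ‖gradient g v‖ * ‖u‖ := by
  have h : ‖gradient g v‖ = ‖fderiv ℝ g v‖ := by simp [gradient]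
  rw [h]
  exact (le_abs_self _).trans ((fderiv ℝ g v).le_opNorm u)

/-- Grönwall bound for a function whose gradient it controls. -/
lemma apply_add_smul_le_mul_exp {E : Type*} [NormedAddCommGroup E]
    [InnerProductSpace ℝ E] [CompleteSpace E] {g : E → ℝ} {τ : ℝ} (hg : Differentiable ℝ g)
    (hself : ∀ v, ‖gradient g v‖ ≤ τ * g v) (v u : E) {t : ℝ} (ht : 0 ≤ t) :
    g (v + t • u) ≤ g v * Real.exp (τ * ‖u‖ * t) := by
  set a := τ * ‖u‖ with ha
  have hderiv : ∀ s : ℝ, HasDerivAt (fun s : ℝ => g (v + s • u) * Real.exp (-(a * s)))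
      ((fderiv ℝ g (v + s • u) u - a * g (v + s • u)) * Real.exp (-(a * s))) s := by
    intro s
    have hexp : HasDerivAt (fun s : ℝ => Real.exp (-(a * s))) (Real.exp (-(a * s)) * -a) s := by
      simpa using ((hasDerivAt_id s).const_mul a).neg.exp
    exact ((hasDerivAt_comp_line hg v u s).mul hexp).congr_deriv (by ring)
  have hanti := antitone_of_hasDerivAt_nonpos hderiv fun s => by
    refine mul_nonpos_of_nonpos_of_nonneg ?_ (Real.exp_pos _).le
    have hmul := mul_le_mul_of_nonneg_right (hself (v + s • u)) (norm_nonneg u)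
    have hdir := fderiv_apply_le_norm_gradient_mul g (v + s • u) u
    rw [ha]
    linarith
  have h := hanti ht
  simp only [zero_smul, add_zero, mul_zero, neg_zero, Real.exp_zero, mul_one, Real.exp_neg] at h
  rwa [← div_eq_mul_inv, div_le_iff₀ (Real.exp_pos _)] at h

/-- Second-order Taylor bound for a convex function whose Hessian trace is self-concordant. -/
lemma ConvexOn.apply_add_le_taylor (hconv : ConvexOn ℝ Set.univ f) (hf : ContDiff ℝ 3 f)
    {τ : ℝ} (hτ : 0 < τ) (hself : ∀ v, ‖gradient (hessTrace f) v‖ ≤ τ * hessTrace f v)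
    (v u : EuclideanSpace ℝ (Fin c)) :
    f (v + u) ≤ f v + fderiv ℝ f v u +
      hessTrace f v * ((Real.exp (τ * ‖u‖) - τ * ‖u‖ - 1) / τ ^ 2) := by
  have hf2 : ContDiff ℝ 2 f := hf.of_le (by norm_num)
  set a := τ * ‖u‖ with ha
  set T := hessTrace f v with hT
  have hexp : ∀ t : ℝ, HasDerivAt (fun s : ℝ => Real.exp (a * s)) (Real.exp (a * t) * a) t := by
    intro t
    simpa using ((hasDerivAt_id t).const_mul a).exp
  have hlin : ∀ t : ℝ, HasDerivAt (fun s : ℝ => a * s) a t := by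
    intro t
    simpa using (hasDerivAt_id t).const_mul a
  have hfirst : ∀ t : ℝ, HasDerivAt
      (fun s : ℝ => s * fderiv ℝ f v u + T / τ ^ 2 * (Real.exp (a * s) - a * s) -
        f (v + s • u))
      (fderiv ℝ f v u + T / τ ^ 2 * (Real.exp (a * t) * a - a) -
        fderiv ℝ f (v + t • u) u) t := by
    intro t
    have hid : HasDerivAt (fun s : ℝ => s * fderiv ℝ f v u) (fderiv ℝ f v u) t := by
      simpa using (hasDerivAt_id t).mul_const (fderiv ℝ f v u)
    exact (hid.add (((hexp t).sub (hlin t)).const_mul _)).sub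
      (hasDerivAt_comp_line (hf2.differentiable (by norm_num)) v u t)
  have hsecond : ∀ t : ℝ, HasDerivAt
      (fun s : ℝ => fderiv ℝ f v u + T / τ ^ 2 * (Real.exp (a * s) * a - a) -
        fderiv ℝ f (v + s • u) u)
      (T / τ ^ 2 * (Real.exp (a * t) * a * a) -
        fderiv ℝ (fderiv ℝ f) (v + t • u) u u) t := by
    intro t
    exact (((((hexp t).mul_const a).sub_const a).const_mul _).const_add _).sub
      (hasDerivAt_fderiv_comp_line hf2 v u t)
  have hsecond_nonneg : ∀ t : ℝ, 0 ≤ t → 0 ≤ T / τ ^ 2 * (Real.exp (a * t) * a * a) -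
      fderiv ℝ (fderiv ℝ f) (v + t • u) u u := by
    intro t ht
    have hhess := fderiv_fderiv_apply_self_le hconv hf2 (v + t • u) u
    have hgrow := mul_le_mul_of_nonneg_left
      (apply_add_smul_le_mul_exp hf.differentiable_hessTrace hself v u ht) (sq_nonneg ‖u‖)
    have heq : T / τ ^ 2 * (Real.exp (a * t) * a * a) = ‖u‖ ^ 2 * (T * Real.exp (a * t)) := by
      rw [ha]
      field_simp
    linarith
  have hmono_first := monotoneOn_of_hasDerivWithinAt_nonneg (convex_Ici (0 : ℝ))
    (fun t _ => (hsecond t).continuousAt.continuousWithinAt)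
    (fun t _ => (hsecond t).hasDerivWithinAt)
    (fun t ht => hsecond_nonneg t (interior_subset ht))
  have hfirst_nonneg : ∀ t : ℝ, 0 ≤ t → 0 ≤ fderiv ℝ f v u +
      T / τ ^ 2 * (Real.exp (a * t) * a - a) - fderiv ℝ f (v + t • u) u := by
    intro t ht
    simpa using hmono_first (Set.mem_Ici.2 le_rfl) (Set.mem_Ici.2 ht) ht
  have hmono := monotoneOn_of_hasDerivWithinAt_nonneg (convex_Ici (0 : ℝ))
    (fun t _ => (hfirst t).continuousAt.continuousWithinAt)
    (fun t _ => (hfirst t).hasDerivWithinAt)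
    (fun t ht => hfirst_nonneg t (interior_subset ht))
  have h := hmono (Set.mem_Ici.2 le_rfl) (Set.mem_Ici.2 zero_le_one) zero_le_one
  simp only [zero_mul, mul_zero, Real.exp_zero, zero_smul, add_zero, one_smul, one_mul,
    mul_one, sub_zero, zero_add] at h
  have heq : T * ((Real.exp a - a - 1) / τ ^ 2) =
      T / τ ^ 2 * (Real.exp a - a) - T / τ ^ 2 := by ring
  linarith

end HessianTrace

lemma Real.exp_sub_self_monotoneOn : MonotoneOn (fun r : ℝ => Real.exp r - r) (Set.Ici 0) := by
  have hderiv : ∀ r : ℝ, HasDerivAt (fun r : ℝ => Real.exp r - r) (Real.exp r - 1) r :=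
    fun r => (Real.hasDerivAt_exp r).sub (hasDerivAt_id r)
  exact monotoneOn_of_hasDerivWithinAt_nonneg (convex_Ici 0)
    (fun r _ => (hderiv r).continuousAt.continuousWithinAt)
    (fun r _ => (hderiv r).hasDerivWithinAt)
    (fun r hr => sub_nonneg.2 (Real.one_le_exp (Set.mem_Ici.1 (interior_subset hr))))

lemma sPen_mul_le {σ t a b : ℝ} (hσ : 0 < σ) (ht : 0 ≤ t) (ha : 0 ≤ a) (hb : 0 ≤ b)
    (hab : t < σ → a ≤ b) : sPen σ t * a ≤ b := by
  unfold sPen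
  split_ifs with h
  · have h0 : 0 ≤ t / σ := div_nonneg ht hσ.le
    have h1 : t / σ ≤ 1 := (div_le_one hσ).2 h.le
    exact (mul_le_of_le_one_left ha (pow_le_one₀ (by linarith) (by linarith))).trans (hab h)
  · simpa using hb

/-- Bound on the perturbed truncated loss:
`ℓ̃_σ(W,x,y) ≤ ℓ(Wx,y) + ‖∇ℓ(Wx,y)‖‖x‖σ + tr(∇²ℓ(Wx,y))·(exp(στ‖x‖) − στ‖x‖ − 1)/τ²`. -/
theorem ellTilde_le_taylor_bound (c d : ℕ) (hc : 0 < c) (hd : 0 < d)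
    (ℓ : EuclideanSpace ℝ (Fin c) → Fin c → ℝ)
    (hnonneg : ∀ v y, 0 ≤ ℓ v y)
    (hconv : ∀ y : Fin c, ConvexOn ℝ Set.univ (fun v => ℓ v y))
    (hsmooth : ∀ y : Fin c, ContDiff ℝ 3 (fun v => ℓ v y))
    (τ : ℝ) (hτ : 0 < τ)
    (hself : ∀ (h : EuclideanSpace ℝ (Fin c)) (y : Fin c),
      ‖gradient (hessTrace fun v => ℓ v y) h‖ ≤ τ * hessTrace (fun v => ℓ v y) h)
    (B σ : ℝ) (hB : 0 < B) (hσ : 0 < σ)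
    (W : Matrix (Fin c) (Fin d) ℝ) (x : EuclideanSpace ℝ (Fin d)) (y : Fin c) :
    ellTilde ℓ B σ W x y ≤
      ℓ (mulVecE W x) y + ‖gradient (fun v => ℓ v y) (mulVecE W x)‖ * ‖x‖ * σ +
        hessTrace (fun v => ℓ v y) (mulVecE W x) *
          ((Real.exp (σ * τ * ‖x‖) - σ * τ * ‖x‖ - 1) / τ ^ 2) := by
  set f := fun v => ℓ v y
  set v := mulVecE W x
  have hT : 0 ≤ hessTrace f v := (hconv y).hessTrace_nonneg ((hsmooth y).of_le (by norm_num)) v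
  have hexp : 0 ≤ Real.exp (σ * τ * ‖x‖) - σ * τ * ‖x‖ - 1 := by
    linarith [Real.add_one_le_exp (σ * τ * ‖x‖)]
  refine ciSup_le fun δ => sPen_mul_le hσ (norm_nonneg δ) (le_min hB.le (hnonneg _ y)) ?_ ?_
  · have := hnonneg v y
    positivity
  · intro hδ
    refine (min_le_right _ _).trans
      (((hconv y).apply_add_le_taylor (hsmooth y) hτ (fun w => hself w y) v (‖x‖ • δ)).trans ?_)
    have hnorm : ‖‖x‖ • δ‖ ≤ ‖x‖ * σ := by
      rw [norm_smul, norm_norm]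
      gcongr
    have hr : τ * ‖‖x‖ • δ‖ ≤ σ * τ * ‖x‖ := by
      calc τ * ‖‖x‖ • δ‖ ≤ τ * (‖x‖ * σ) := by gcongr
        _ = σ * τ * ‖x‖ := by ring
    have hmono := Real.exp_sub_self_monotoneOn (Set.mem_Ici.2 (by positivity))
      (Set.mem_Ici.2 (by positivity)) hr
    have hgrad : fderiv ℝ f v (‖x‖ • δ) ≤ ‖gradient f v‖ * ‖x‖ * σ := by
      rw [mul_assoc]
      exact (fderiv_apply_le_norm_gradient_mul f v _).trans (by gcongr)
    dsimp only at hmono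
    gcongr ?_ + ?_ + hessTrace f v * (?_ / τ ^ 2)
    · exact le_rfl
    · linarith
end

section
/- Let c, d be positive integers, let ℓ : ℝ^c × {1,…,c} → ℝ be continuous and nonnegative, let B > 0 and σ > 0. Then for any W, W' ∈ ℝ^{c×d}, any nonzero x ∈ ℝ^d, and any label y: (ℓ̃_σ(W,x,y) − ℓ̃_σ(W',x,y))² ≤ (ℓ̃_σ(W,x,y) + ℓ̃_σ(W',x,y)) · 4B·‖Wx − W'x‖₂² / (‖x‖₂² σ²). -/
open MeasureTheory

lemma sPen_eq_max_sq {σ : ℝ} (hσ : 0 < σ) (t : ℝ) : sPen σ t = max 0 (1 - t / σ) ^ 2 := by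
  unfold sPen
  split_ifs with h
  · rw [max_eq_right (sub_nonneg.2 ((div_le_one hσ).2 h.le))]
  · rw [max_eq_left (sub_nonpos.2 ((one_le_div hσ).2 (not_lt.1 h)))]
    norm_num

lemma max_ramp_le_one {σ t : ℝ} (hσ : 0 < σ) (ht : 0 ≤ t) : max 0 (1 - t / σ) ≤ 1 :=
  max_le zero_le_one (sub_le_self _ (by positivity))

section

variable {c d : ℕ} {ℓ : EuclideanSpace ℝ (Fin c) → Fin c → ℝ} {B σ : ℝ}

lemma bddAbove_ellTilde (hnonneg : ∀ v y, 0 ≤ ℓ v y) (hB : 0 < B) (hσ : 0 < σ)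
    (W : Matrix (Fin c) (Fin d) ℝ) (x : EuclideanSpace ℝ (Fin d)) (y : Fin c) :
    BddAbove (Set.range fun δ : EuclideanSpace ℝ (Fin c) =>
      sPen σ ‖δ‖ * min B (ℓ (mulVecE W x + ‖x‖ • δ) y)) := by
  refine ⟨B, ?_⟩
  rintro _ ⟨δ, rfl⟩
  have h1 : sPen σ ‖δ‖ ≤ 1 := by
    rw [sPen_eq_max_sq hσ]
    exact pow_le_one₀ (le_max_left _ _) (max_ramp_le_one hσ (norm_nonneg δ))
  exact (mul_le_of_le_one_left (le_min hB.le (hnonneg _ _)) h1).trans (min_le_left _ _)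

lemma ellTilde_nonneg (hnonneg : ∀ v y, 0 ≤ ℓ v y) (hB : 0 < B) (hσ : 0 < σ)
    (W : Matrix (Fin c) (Fin d) ℝ) (x : EuclideanSpace ℝ (Fin d)) (y : Fin c) :
    0 ≤ ellTilde ℓ B σ W x y := by
  refine Real.iSup_nonneg fun δ => mul_nonneg ?_ (le_min hB.le (hnonneg _ _))
  rw [sPen_eq_max_sq hσ]
  positivity

/-- The square root of the perturbed truncated loss is Lipschitz in the prediction `W x`. -/
lemma sqrt_ellTilde_le (hnonneg : ∀ v y, 0 ≤ ℓ v y) (hB : 0 < B) (hσ : 0 < σ)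
    (W W' : Matrix (Fin c) (Fin d) ℝ) {x : EuclideanSpace ℝ (Fin d)} (hx : x ≠ 0) (y : Fin c) :
    √(ellTilde ℓ B σ W x y) ≤ √(ellTilde ℓ B σ W' x y) +
      ‖mulVecE W x - mulVecE W' x‖ / (‖x‖ * σ) * √B := by
  have hx' : 0 < ‖x‖ := norm_pos_iff.2 hx
  refine Real.sqrt_le_iff.2 ⟨by positivity, ciSup_le fun δ => ?_⟩
  set g := min B (ℓ (mulVecE W x + ‖x‖ • δ) y) with hg
  set r := ‖mulVecE W x - mulVecE W' x‖ / (‖x‖ * σ) with hr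
  have hg0 : 0 ≤ g := le_min hB.le (hnonneg _ _)
  set δ' := δ + ‖x‖⁻¹ • (mulVecE W x - mulVecE W' x) with hδ'
  have hz : mulVecE W' x + ‖x‖ • δ' = mulVecE W x + ‖x‖ • δ := by
    rw [hδ', smul_add, smul_inv_smul₀ hx'.ne']
    abel
  have hle : sPen σ ‖δ'‖ * g ≤ ellTilde ℓ B σ W' x y := by
    have h := le_ciSup (bddAbove_ellTilde hnonneg hB hσ W' x y) δ'
    simp only [hz] at h
    exact h
  have hnorm : ‖δ'‖ / σ ≤ ‖δ‖ / σ + r := by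
    have h : ‖δ'‖ ≤ ‖δ‖ + ‖x‖⁻¹ * ‖mulVecE W x - mulVecE W' x‖ := by
      simpa [norm_smul] using norm_add_le δ (‖x‖⁻¹ • (mulVecE W x - mulVecE W' x))
    calc ‖δ'‖ / σ ≤ (‖δ‖ + ‖x‖⁻¹ * ‖mulVecE W x - mulVecE W' x‖) / σ := by gcongr
      _ = ‖δ‖ / σ + r := by rw [hr]; field_simp
  have hr0 : 0 ≤ r := by positivity
  rw [sPen_eq_max_sq hσ] at hle ⊢
  have hramp : max 0 (1 - ‖δ‖ / σ) ≤ max 0 (1 - ‖δ'‖ / σ) + r :=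
    max_le (by positivity) (by linarith [le_max_right 0 (1 - ‖δ'‖ / σ)])
  have hsqrt : max 0 (1 - ‖δ'‖ / σ) * √g ≤ √(ellTilde ℓ B σ W' x y) := by
    refine Real.le_sqrt_of_sq_le ?_
    rwa [mul_pow, Real.sq_sqrt hg0]
  have hgB : √g ≤ √B := Real.sqrt_le_sqrt (min_le_left _ _)
  calc max 0 (1 - ‖δ‖ / σ) ^ 2 * g = (max 0 (1 - ‖δ‖ / σ) * √g) ^ 2 := by
        rw [mul_pow, Real.sq_sqrt hg0]
    _ ≤ ((max 0 (1 - ‖δ'‖ / σ) + r) * √g) ^ 2 := by gcongr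
    _ = (max 0 (1 - ‖δ'‖ / σ) * √g + r * √g) ^ 2 := by ring
    _ ≤ (√(ellTilde ℓ B σ W' x y) + r * √B) ^ 2 := by gcongr

end

/-- `(ℓ̃_σ(W,x,y) − ℓ̃_σ(W',x,y))² ≤ (ℓ̃_σ(W,x,y) + ℓ̃_σ(W',x,y)) · 4B‖Wx−W'x‖²/(‖x‖²σ²)`. -/
theorem ellTilde_smooth (c d : ℕ) (hc : 0 < c) (hd : 0 < d)
    (ℓ : EuclideanSpace ℝ (Fin c) → Fin c → ℝ)
    (hcont : Continuous fun vy : EuclideanSpace ℝ (Fin c) × Fin c => ℓ vy.1 vy.2)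
    (hnonneg : ∀ v y, 0 ≤ ℓ v y) (B σ : ℝ) (hB : 0 < B) (hσ : 0 < σ)
    (W W' : Matrix (Fin c) (Fin d) ℝ) (x : EuclideanSpace ℝ (Fin d)) (hx : x ≠ 0)
    (y : Fin c) :
    (ellTilde ℓ B σ W x y - ellTilde ℓ B σ W' x y) ^ 2 ≤
      (ellTilde ℓ B σ W x y + ellTilde ℓ B σ W' x y) *
        (4 * B * ‖mulVecE W x - mulVecE W' x‖ ^ 2 / (‖x‖ ^ 2 * σ ^ 2)) := by
  have ha := ellTilde_nonneg hnonneg hB hσ W x y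
  have hb := ellTilde_nonneg hnonneg hB hσ W' x y
  have h1 := sqrt_ellTilde_le hnonneg hB hσ W W' hx y
  have h2 := sqrt_ellTilde_le hnonneg hB hσ W' W hx y
  rw [norm_sub_rev] at h2
  set a := ellTilde ℓ B σ W x y
  set b := ellTilde ℓ B σ W' x y
  set r := ‖mulVecE W x - mulVecE W' x‖ / (‖x‖ * σ) with hr
  have hdiff : (√a - √b) ^ 2 ≤ r ^ 2 * B := by
    rw [← Real.sq_sqrt hB.le, ← mul_pow]
    exact sq_le_sq' (by linarith) (by linarith)
  have hsum : (√a + √b) ^ 2 ≤ 2 * (a + b) := by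
    simpa [Real.sq_sqrt ha, Real.sq_sqrt hb] using add_sq_le (a := √a) (b := √b)
  calc (a - b) ^ 2 = (√a - √b) ^ 2 * (√a + √b) ^ 2 := by
        rw [← mul_pow, mul_comm, ← sq_sub_sq, Real.sq_sqrt ha, Real.sq_sqrt hb]
    _ ≤ r ^ 2 * B * (2 * (a + b)) := by gcongr
    _ ≤ (a + b) * (4 * (r ^ 2 * B)) := by
        have : 0 ≤ (a + b) * (r ^ 2 * B) := by positivity
        linarith
    _ = _ := by rw [hr, div_pow, mul_pow]; ring
end

section
/- Let c, d, n be positive integers, let x₁,…,xₙ ∈ ℝ^d be nonzero vectors with labels y₁,…,yₙ, let ℓ be a continuous nonnegative loss, B > 0, σ > 0, A > 0, r ≥ 0, and define 𝒲(r) = {W ∈ ℝ^{c×d} : ‖Wᵀ‖_{2,1} ≤ A and (1/n) Σ_i ℓ̃_σ(W,x_i,y_i) ≤ r}. Then for every ε > 0 there exists a finite set 𝒲̄_ε ⊆ 𝒲(r) with log|𝒲̄_ε| ≤ 1152·⌊4A²/ε²⌋·(log₂(2·⌈16A/ε + 2⌉·n + 1) + log c) such that for every W ∈ 𝒲(r)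 there exists W̄ ∈ 𝒲̄_ε with ‖Wx_i − W̄x_i‖₂/‖x_i‖₂ ≤ ε for all i = 1,…,n. -/
open MeasureTheory

open scoped RealInnerProductSpace

/-- An update of one row by a signed multiple of one of the vectors `u i`; the size of the update
in row `y` is `h y`. -/
noncomputable def rowUpdate {ι κ E : Type*} [DecidableEq ι] [AddCommGroup E] [Module ℝ E]
    (h : ι → ℝ) (u : κ → E) : Option (ι × κ × Bool) → ι → E
  | none => 0
  | some (y, i, b) => Pi.single y ((cond b (h y) (-h y)) • u i)

/-- The number of times each index is selected. -/
def selectionCount {ι : Type*} [DecidableEq ι] {K : ℕ} (q : Fin K → Option ι) (y : ι) : ℕ :=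
  ∑ t, if q t = some y then 1 else 0

lemma exists_selectionCount_eq {ι : Type*} [Fintype ι] [DecidableEq ι] (K : ℕ) (m : ι → ℕ)
    (hm : ∑ y, m y ≤ K) : ∃ q : Fin K → Option ι, selectionCount q = m := by
  induction K generalizing m with
  | zero =>
    refine ⟨Fin.elim0, funext fun y => ?_⟩
    have := Finset.single_le_sum (f := m) (fun _ _ => Nat.zero_le _) (Finset.mem_univ y)
    simp [selectionCount]
    omega
  | succ K ih =>
    by_cases h : ∀ y, m y = 0
    · exact ⟨fun _ => none, funext fun y => by simp [selectionCount, h]⟩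
    · push Not at h
      obtain ⟨y, hy⟩ := h
      have hsum : ∑ z, m z = ∑ z, (Function.update m y (m y - 1)) z + 1 := by
        rw [Finset.sum_update_of_mem (Finset.mem_univ y),
          ← Finset.add_sum_erase _ _ (Finset.mem_univ y), Finset.sdiff_singleton_eq_erase]
        omega
      obtain ⟨q, hq⟩ := ih (Function.update m y (m y - 1)) (by omega)
      refine ⟨Fin.cons (some y) q, funext fun z => ?_⟩
      have hz := congrFun hq z
      simp only [selectionCount] at hz
      simp only [selectionCount, Fin.sum_univ_succ, Fin.cons_zero, Fin.cons_succ, hz]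
      by_cases hzy : z = y
      · subst hzy
        simp
        omega
      · simp [hzy, Ne.symm hzy]

section Greedy

variable {ι κ E : Type*} [Fintype ι] [DecidableEq ι] [NormedAddCommGroup E]
  [InnerProductSpace ℝ E]

/-- Updating a row whose residual correlates with some `u i` decreases the weighted energy. -/
lemma exists_rowUpdate_energy_le (m : ι → ℝ) {u : κ → E} (hu : ∀ i, ‖u i‖ = 1) {η : ℝ}
    (hη : 0 < η) (w : ι → E) {y : ι} (hy : 0 < m y) {i : κ}
    (hi : η ^ 2 * m y < ⟪w y, u i⟫ ^ 2) :
    ∃ p, ∑ z, ‖(w - rowUpdate (fun z => η * √(m z)) u p) z‖ ^ 2 / m z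
      ≤ ∑ z, ‖w z‖ ^ 2 / m z - η ^ 2 := by
  set h := η * √(m y) with hh
  have hpos : 0 < h := mul_pos hη (Real.sqrt_pos.2 hy)
  have hsq : h ^ 2 = η ^ 2 * m y := by rw [hh, mul_pow, Real.sq_sqrt hy.le]
  have habs : h < |⟪w y, u i⟫| := lt_of_pow_lt_pow_left₀ 2 (abs_nonneg _) (by rwa [sq_abs, hsq])
  obtain ⟨b, hb⟩ : ∃ b : Bool, h ^ 2 ≤ cond b h (-h) * ⟪w y, u i⟫ := by
    rcases lt_abs.1 habs with h' | h'
    · exact ⟨true, by simp only [cond_true]; nlinarith⟩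
    · exact ⟨false, by simp only [cond_false]; nlinarith⟩
  refine ⟨some (y, i, b), ?_⟩
  have hrow : ‖w y - cond b h (-h) • u i‖ ^ 2 ≤ ‖w y‖ ^ 2 - h ^ 2 := by
    have hc : cond b h (-h) ^ 2 = h ^ 2 := by cases b <;> simp
    rw [norm_sub_sq_real, real_inner_smul_right, norm_smul, hu, mul_one, Real.norm_eq_abs, sq_abs,
      hc]
    linarith
  rw [← Finset.add_sum_erase _ _ (Finset.mem_univ y),
    ← Finset.add_sum_erase _ (fun z => ‖w z‖ ^ 2 / m z) (Finset.mem_univ y)]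
  have hrest : ∑ z ∈ Finset.univ.erase y,
      ‖(w - rowUpdate (fun z => η * √(m z)) u (some (y, i, b))) z‖ ^ 2 / m z
      = ∑ z ∈ Finset.univ.erase y, ‖w z‖ ^ 2 / m z := by
    refine Finset.sum_congr rfl fun z hz => ?_
    simp [rowUpdate, Finset.ne_of_mem_erase hz]
  have hfirst : ‖(w - rowUpdate (fun z => η * √(m z)) u (some (y, i, b))) y‖ ^ 2 / m y
      ≤ ‖w y‖ ^ 2 / m y - η ^ 2 := by
    have : ‖w y‖ ^ 2 / m y - η ^ 2 = (‖w y‖ ^ 2 - h ^ 2) / m y := by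
      rw [hsq]; field_simp
    rw [this]
    simp only [rowUpdate, Pi.sub_apply, Pi.single_eq_same]
    gcongr
  rw [hrest]
  linarith

/-- Greedy approximation: energy `T η²` is exhausted after at most `T` row updates. -/
lemma exists_sum_rowUpdate_approx (m : ι → ℝ) (hm : ∀ y, 0 ≤ m y) {u : κ → E}
    (hu : ∀ i, ‖u i‖ = 1) {η : ℝ} (hη : 0 < η) (T : ℕ) (w : ι → E)
    (hw : ∑ y, ‖w y‖ ^ 2 / m y ≤ T * η ^ 2) :
    ∃ p : Fin T → Option (ι × κ × Bool), ∀ y i, 0 < m y →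
      ⟪(w - ∑ t, rowUpdate (fun z => η * √(m z)) u (p t)) y, u i⟫ ^ 2 ≤ η ^ 2 * m y := by
  induction T generalizing w with
  | zero =>
    refine ⟨Fin.elim0, fun y i hy => ?_⟩
    by_contra! hi
    simp only [Finset.univ_eq_empty, Finset.sum_empty, sub_zero] at hi
    obtain ⟨p, hp⟩ := exists_rowUpdate_energy_le m hu hη w hy hi
    have := Finset.sum_nonneg fun z (_ : z ∈ Finset.univ) =>
      div_nonneg (sq_nonneg ‖(w - rowUpdate (fun z => η * √(m z)) u p) z‖) (hm z)
    have := pow_pos hη 2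
    simp only [Nat.cast_zero, zero_mul] at hw
    linarith
  | succ T ih =>
    by_cases hgood : ∀ y i, 0 < m y → ⟪w y, u i⟫ ^ 2 ≤ η ^ 2 * m y
    · exact ⟨fun _ => none, by simpa [rowUpdate] using hgood⟩
    push Not at hgood
    obtain ⟨y, i, hy, hi⟩ := hgood
    obtain ⟨p, hp⟩ := exists_rowUpdate_energy_le m hu hη w hy hi
    push_cast at hw
    obtain ⟨q, hq⟩ := ih (w - rowUpdate (fun z => η * √(m z)) u p) (by linarith)
    refine ⟨Fin.cons p q, fun z j hz => ?_⟩
    rw [Fin.sum_univ_succ, ← sub_sub]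
    simpa only [Fin.cons_zero, Fin.cons_succ] using hq z j hz

/-- Families of rows with total norm at most `A` are approximated, up to `ε / 2`, by sums of `8M`
row updates whose sizes are given by `4M` selections of rows. -/
lemma exists_rowUpdate_code {u : κ → E} (hu : ∀ i, ‖u i‖ = 1) {A ε : ℝ} (hA : 0 < A)
    (hε : 0 < ε) {M : ℕ} (hM : 0 < M) (hAM : 2 * A ^ 2 ≤ M * ε ^ 2) (w : ι → E)
    (hw : ∑ y, ‖w y‖ ≤ A) :
    ∃ (q : Fin (4 * M) → Option ι) (p : Fin (8 * M) → Option (ι × κ × Bool)), ∀ i,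
      ∑ y, ⟪w y - (∑ t, rowUpdate (fun z => √(ε ^ 2 / (32 * M)) * √(selectionCount q z : ℝ)) u
        (p t)) y, u i⟫ ^ 2 ≤ (ε / 2) ^ 2 := by
  have hM' : (0 : ℝ) < M := by exact_mod_cast hM
  set η := √(ε ^ 2 / (32 * M)) with hη
  have hη0 : 0 < η := by positivity
  have hη2 : η ^ 2 = ε ^ 2 / (32 * M) := Real.sq_sqrt (by positivity)
  set m : ι → ℕ := fun y => ⌊4 * M * ‖w y‖ / A⌋₊ with hmdef
  have hm_le : ∀ y, (m y : ℝ) ≤ 4 * M * ‖w y‖ / A := fun y => Nat.floor_le (by positivity)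
  have hlt_m : ∀ y, 4 * M * ‖w y‖ / A < m y + 1 := fun y => Nat.lt_floor_add_one _
  have hmsum : ∑ y, (m y : ℝ) ≤ 4 * M := calc
    ∑ y, (m y : ℝ) ≤ ∑ y, 4 * M * ‖w y‖ / A := Finset.sum_le_sum fun y _ => hm_le y
    _ = 4 * M / A * ∑ y, ‖w y‖ := by rw [Finset.mul_sum]; congr! 1; ring
    _ ≤ 4 * M / A * A := by gcongr
    _ = 4 * M := by field_simp
  obtain ⟨q, hq⟩ := exists_selectionCount_eq (4 * M) m (by exact_mod_cast hmsum)
  have henergy : ∑ y, ‖w y‖ ^ 2 / (m y : ℝ) ≤ (8 * M : ℕ) * η ^ 2 := calc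
    ∑ y, ‖w y‖ ^ 2 / (m y : ℝ) ≤ ∑ y, A / (2 * M) * ‖w y‖ := by
      refine Finset.sum_le_sum fun y _ => ?_
      rcases Nat.eq_zero_or_pos (m y) with h0 | h0
      · rw [h0, Nat.cast_zero, div_zero]; positivity
      · have h1 : (1 : ℝ) ≤ m y := by exact_mod_cast h0
        have h2 := hlt_m y
        rw [div_lt_iff₀ hA] at h2
        have h3 : 2 * M * ‖w y‖ ≤ A * m y := by nlinarith
        have h4 := mul_le_mul_of_nonneg_right h3 (norm_nonneg (w y))
        rw [div_le_iff₀ (by linarith), div_mul_eq_mul_div, div_mul_eq_mul_div,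
          le_div_iff₀ (by positivity)]
        nlinarith
    _ = A / (2 * M) * ∑ y, ‖w y‖ := by rw [Finset.mul_sum]
    _ ≤ A / (2 * M) * A := by gcongr
    _ ≤ (8 * M : ℕ) * η ^ 2 := by
      rw [hη2]
      push_cast
      rw [show 8 * (M : ℝ) * (ε ^ 2 / (32 * M)) = ε ^ 2 / 4 by field_simp; norm_num,
        div_mul_eq_mul_div, div_le_div_iff₀ (by positivity) (by norm_num)]
      nlinarith
  obtain ⟨p, hp⟩ := exists_sum_rowUpdate_approx (fun y => (m y : ℝ)) (fun y => Nat.cast_nonneg _)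
    hu hη0 (8 * M) w henergy
  refine ⟨q, p, fun i => ?_⟩
  rw [hq]
  have hterm : ∀ y, ⟪w y - (∑ t, rowUpdate (fun z => η * √(m z : ℝ)) u (p t)) y, u i⟫ ^ 2
      ≤ η ^ 2 * m y + A / (4 * M) * ‖w y‖ := by
    intro y
    rcases Nat.eq_zero_or_pos (m y) with h0 | h0
    · have hzero : (∑ t, rowUpdate (fun z => η * √(m z : ℝ)) u (p t)) y = 0 := by
        rw [Finset.sum_apply]
        refine Finset.sum_eq_zero fun t _ => ?_
        rcases p t with _ | ⟨z, j, b⟩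
        · rfl
        · by_cases hz : y = z
          · subst hz; cases b <;> simp [rowUpdate, h0]
          · simp [rowUpdate, hz]
      have h2 := hlt_m y
      rw [div_lt_iff₀ hA, h0] at h2
      have h3 : |⟪w y, u i⟫| ≤ ‖w y‖ := by simpa [hu i] using abs_real_inner_le_norm (w y) (u i)
      have h4 : ‖w y‖ ≤ A / (4 * M) := by
        rw [le_div_iff₀ (by positivity)]; push_cast at h2; linarith
      rw [hzero, sub_zero, h0, ← sq_abs]
      push_cast
      nlinarith [abs_nonneg ⟪w y, u i⟫, norm_nonneg (w y)]
    · have := hp y i (by exact_mod_cast h0)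
      rw [Pi.sub_apply] at this
      have : 0 ≤ A / (4 * M) * ‖w y‖ := by positivity
      linarith
  calc ∑ y, ⟪w y - (∑ t, rowUpdate (fun z => η * √(m z : ℝ)) u (p t)) y, u i⟫ ^ 2
      ≤ ∑ y, (η ^ 2 * m y + A / (4 * M) * ‖w y‖) := Finset.sum_le_sum fun y _ => hterm y
    _ = η ^ 2 * ∑ y, (m y : ℝ) + A / (4 * M) * ∑ y, ‖w y‖ := by
      rw [Finset.sum_add_distrib, Finset.mul_sum, Finset.mul_sum]
    _ ≤ η ^ 2 * (4 * M) + A / (4 * M) * A := by gcongr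
    _ ≤ ε ^ 2 / 8 + ε ^ 2 / 8 := by
      gcongr
      · rw [hη2]; apply le_of_eq; field_simp; norm_num
      · rw [div_mul_eq_mul_div, div_le_div_iff₀ (by positivity) (by norm_num)]
        nlinarith
    _ = (ε / 2) ^ 2 := by ring

end Greedy

/-- A cover of `P` by `card ι` cells contains a cover whose centers lie in `P`. -/
lemma exists_internal_cover {α ι : Type*} [Fintype ι] (P : Set α) (R : ι → α → Prop)
    (h : ∀ a ∈ P, ∃ i, R i a) :
    ∃ S : Finset α, (↑S : Set α) ⊆ P ∧ S.card ≤ Fintype.card ι ∧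
      ∀ a ∈ P, ∃ b ∈ S, ∃ i, R i a ∧ R i b := by
  classical
  let J := Finset.univ.filter fun i => ∃ a ∈ P, R i a
  have hJ : ∀ i : J, ∃ a ∈ P, R i a := fun i => (Finset.mem_filter.1 i.2).2
  choose f hfP hfR using hJ
  refine ⟨Finset.univ.image f, ?_, ?_, fun a ha => ?_⟩
  · intro b hb
    obtain ⟨i, -, rfl⟩ := Finset.mem_image.1 (Finset.mem_coe.1 hb)
    exact hfP i
  · refine Finset.card_image_le.trans ?_
    rw [Finset.card_univ, Fintype.card_coe]
    exact Finset.card_le_univ J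
  · obtain ⟨i, hi⟩ := h a ha
    let j : J := ⟨i, Finset.mem_filter.2 ⟨Finset.mem_univ i, a, ha, hi⟩⟩
    exact ⟨f j, Finset.mem_image_of_mem f (Finset.mem_univ j), i, hi, hfR j⟩

lemma norm_mulVecE_sub_sq {c d : ℕ} (W V : Matrix (Fin c) (Fin d) ℝ)
    (x : EuclideanSpace ℝ (Fin d)) :
    ‖mulVecE W x - mulVecE V x‖ ^ 2
      = ∑ y, ⟪(WithLp.toLp 2 (W y) : EuclideanSpace ℝ (Fin d)) - WithLp.toLp 2 (V y), x⟫ ^ 2 := by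
  rw [EuclideanSpace.norm_sq_eq]
  refine Finset.sum_congr rfl fun y _ => ?_
  rw [Real.norm_eq_abs, sq_abs, inner_sub_left]
  simp [mulVecE, Matrix.mulVec, dotProduct, PiLp.inner_apply, mul_comm]

/-- The ball of radius `A` in the row-sum norm has a finite cover at scale `ε / 2`. -/
lemma exists_rowNormSum_cover {c d n : ℕ} (hn : 0 < n) {x : Fin n → EuclideanSpace ℝ (Fin d)}
    (hx : ∀ i, x i ≠ 0) {A ε : ℝ} (hA : 0 < A) (hε : 0 < ε) (M : ℕ)
    (hAM : 4 * A ^ 2 / ε ^ 2 < M + 1) :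
    ∃ (ι : Type) (_ : Fintype ι) (F : ι → Matrix (Fin c) (Fin d) ℝ),
      Fintype.card ι ≤ (2 * n * c + 1) ^ (12 * M) ∧
      ∀ W, rowNormSum W ≤ A → ∃ j, ∀ i,
        ‖mulVecE W (x i) - mulVecE (F j) (x i)‖ / ‖x i‖ ≤ ε / 2 := by
  rw [div_lt_iff₀ (by positivity)] at hAM
  have hscale : ∀ (W V : Matrix (Fin c) (Fin d) ℝ) i,
      ∑ y, ⟪(WithLp.toLp 2 (W y) : EuclideanSpace ℝ (Fin d)) - WithLp.toLp 2 (V y),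
        ‖x i‖⁻¹ • x i⟫ ^ 2 ≤ (ε / 2) ^ 2 →
      ‖mulVecE W (x i) - mulVecE V (x i)‖ / ‖x i‖ ≤ ε / 2 := by
    intro W V i h
    refine le_of_sq_le_sq ?_ (by positivity)
    rw [div_pow, norm_mulVecE_sub_sq, div_eq_inv_mul, Finset.mul_sum]
    simpa only [real_inner_smul_right, mul_pow, inv_pow] using h
  have hu : ∀ i, ‖‖x i‖⁻¹ • x i‖ = 1 := fun i => norm_smul_inv_norm (hx i)
  rcases Nat.eq_zero_or_pos M with rfl | hM
  · refine ⟨Unit, inferInstance, fun _ => 0, by simp, fun W hW => ⟨(), fun i => hscale W 0 i ?_⟩⟩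
    have hAε : A ^ 2 ≤ (ε / 2) ^ 2 := by push_cast at hAM; nlinarith
    refine le_trans ?_ hAε
    calc _ ≤ ∑ y, ‖(WithLp.toLp 2 (W y) : EuclideanSpace ℝ (Fin d))‖ ^ 2 := by
          refine Finset.sum_le_sum fun y _ => ?_
          have := abs_real_inner_le_norm (WithLp.toLp 2 (W y)) (‖x i‖⁻¹ • x i)
          rw [hu, mul_one] at this
          rw [show (WithLp.toLp 2 ((0 : Matrix (Fin c) (Fin d) ℝ) y)
            : EuclideanSpace ℝ (Fin d)) = 0 from rfl, sub_zero, ← sq_abs]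
          gcongr
      _ ≤ (∑ y, ‖(WithLp.toLp 2 (W y) : EuclideanSpace ℝ (Fin d))‖) ^ 2 :=
          Finset.sum_sq_le_sq_sum_of_nonneg fun _ _ => norm_nonneg _
      _ ≤ A ^ 2 := by
          gcongr
          exact hW
  · have hAM' : 2 * A ^ 2 ≤ M * ε ^ 2 := by
      have : (1 : ℝ) ≤ M := by exact_mod_cast hM
      nlinarith [sq_nonneg ε]
    refine ⟨(Fin (4 * M) → Option (Fin c)) × (Fin (8 * M) → Option (Fin c × Fin n × Bool)),
      inferInstance, fun j => Matrix.of fun y => (∑ t, rowUpdate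
        (fun z => √(ε ^ 2 / (32 * M)) * √(selectionCount j.1 z : ℝ))
        (fun i => ‖x i‖⁻¹ • x i) (j.2 t)) y, ?_, fun W hW => ?_⟩
    · rw [Fintype.card_prod, Fintype.card_fun, Fintype.card_fun]
      simp only [Fintype.card_option, Fintype.card_prod, Fintype.card_fin, Fintype.card_bool]
      rw [show 12 * M = 4 * M + 8 * M by ring, pow_add]
      exact Nat.mul_le_mul (Nat.pow_le_pow_left (by nlinarith) _)
        (Nat.pow_le_pow_left (by linarith) _)
    · obtain ⟨q, p, hqp⟩ := exists_rowUpdate_code hu hA hε hM hAM'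
        (fun y => (WithLp.toLp 2 (W y) : EuclideanSpace ℝ (Fin d))) hW
      exact ⟨(q, p), fun i => hscale W _ i (hqp i)⟩

/-- Covering number bound for the class
`𝒲(r) = {W : ‖Wᵀ‖_{2,1} ≤ A, (1/n)∑ᵢ ℓ̃_σ(W,xᵢ,yᵢ) ≤ r}` in the sample-wise
normalized prediction metric. -/
theorem matrix_class_cover (c d n : ℕ) (hc : 0 < c) (hd : 0 < d) (hn : 0 < n)
    (x : Fin n → EuclideanSpace ℝ (Fin d)) (hx : ∀ i, x i ≠ 0) (y : Fin n → Fin c)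
    (ℓ : EuclideanSpace ℝ (Fin c) → Fin c → ℝ)
    (hcont : Continuous fun vy : EuclideanSpace ℝ (Fin c) × Fin c => ℓ vy.1 vy.2)
    (hnonneg : ∀ v yy, 0 ≤ ℓ v yy)
    (B σ A r : ℝ) (hB : 0 < B) (hσ : 0 < σ) (hA : 0 < A) (hr : 0 ≤ r) :
    ∀ ε : ℝ, 0 < ε →
      ∃ S : Finset (Matrix (Fin c) (Fin d) ℝ),
        (↑S : Set (Matrix (Fin c) (Fin d) ℝ)) ⊆
          {W | rowNormSum W ≤ A ∧ (1 / n : ℝ) * ∑ i, ellTilde ℓ B σ W (x i) (y i) ≤ r} ∧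
        Real.log S.card ≤
          1152 * (⌊4 * A ^ 2 / ε ^ 2⌋ : ℝ) *
            (Real.logb 2 (2 * (⌈16 * A / ε + 2⌉₊ : ℝ) * n + 1) + Real.log c) ∧
        ∀ W, rowNormSum W ≤ A → (1 / n : ℝ) * ∑ i, ellTilde ℓ B σ W (x i) (y i) ≤ r →
          ∃ Wb ∈ S, ∀ i : Fin n,
            ‖mulVecE W (x i) - mulVecE Wb (x i)‖ / ‖x i‖ ≤ ε := by
  intro ε hε
  set M := ⌊4 * A ^ 2 / ε ^ 2⌋₊ with hM
  have hfloor : (⌊4 * A ^ 2 / ε ^ 2⌋ : ℝ) = M := by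
    rw [hM, ← Int.cast_natCast, Int.natCast_floor_eq_floor (by positivity)]
  obtain ⟨ι, _, F, hcard, hF⟩ := exists_rowNormSum_cover (c := c) hn hx hA hε M
    (Nat.lt_floor_add_one _)
  obtain ⟨S, hSP, hScard, hS⟩ := exists_internal_cover
    {W | rowNormSum W ≤ A ∧ (1 / n : ℝ) * ∑ i, ellTilde ℓ B σ W (x i) (y i) ≤ r}
    (fun j W => ∀ i, ‖mulVecE W (x i) - mulVecE (F j) (x i)‖ / ‖x i‖ ≤ ε / 2)
    (fun W hW => hF W hW.1)
  refine ⟨S, hSP, ?_, fun W hWA hWr => ?_⟩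
  · have hc' : (1 : ℝ) ≤ c := by exact_mod_cast hc
    have hn' : (1 : ℝ) ≤ n := by exact_mod_cast hn
    have hk : (1 : ℝ) ≤ (⌈16 * A / ε + 2⌉₊ : ℝ) := by
      exact_mod_cast Nat.one_le_ceil_iff.2 (by positivity)
    set k : ℝ := (⌈16 * A / ε + 2⌉₊ : ℝ)
    have hbig : (1 : ℝ) ≤ 2 * k * n + 1 := by nlinarith
    have hlog : Real.log (2 * n * c + 1) ≤ Real.logb 2 (2 * k * n + 1) + Real.log c := calc
      Real.log (2 * n * c + 1) ≤ Real.log ((2 * k * n + 1) * c) := by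
        apply Real.log_le_log (by positivity)
        have : 2 * (n : ℝ) * c ≤ 2 * k * n * c := by
          have : (0 : ℝ) ≤ n * c := by positivity
          nlinarith
        nlinarith
      _ = Real.log (2 * k * n + 1) + Real.log c :=
        Real.log_mul (by positivity) (by positivity)
      _ ≤ Real.logb 2 (2 * k * n + 1) + Real.log c := by
        gcongr
        rw [Real.logb, le_div_iff₀ (Real.log_pos one_lt_two)]
        exact mul_le_of_le_one_right (Real.log_nonneg hbig)
          (Real.log_two_lt_d9.le.trans (by norm_num))
    have hL : 0 ≤ Real.logb 2 (2 * k * n + 1) + Real.log c :=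
      (Real.log_nonneg (by nlinarith)).trans hlog
    rw [hfloor]
    rcases S.card.eq_zero_or_pos with h0 | h0
    · rw [h0, Nat.cast_zero, Real.log_zero]
      positivity
    · calc Real.log S.card ≤ Real.log ((2 * n * c + 1) ^ (12 * M)) := by
            apply Real.log_le_log (by exact_mod_cast h0)
            exact_mod_cast hScard.trans hcard
        _ = 12 * M * Real.log (2 * n * c + 1) := by rw [Real.log_pow]; push_cast; ring
        _ ≤ 12 * M * (Real.logb 2 (2 * k * n + 1) + Real.log c) := by gcongr
        _ ≤ 1152 * M * (Real.logb 2 (2 * k * n + 1) + Real.log c) := by gcongr; norm_num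
  · obtain ⟨V, hV, j, hWj, hVj⟩ := hS W ⟨hWA, hWr⟩
    refine ⟨V, hV, fun i => ?_⟩
    calc ‖mulVecE W (x i) - mulVecE V (x i)‖ / ‖x i‖
        ≤ (‖mulVecE W (x i) - mulVecE (F j) (x i)‖ + ‖mulVecE V (x i) - mulVecE (F j) (x i)‖)
          / ‖x i‖ := by
          gcongr
          rw [norm_sub_rev (mulVecE V (x i))]
          exact norm_sub_le_norm_sub_add_norm_sub _ _ _
      _ ≤ ε := by
          rw [add_div]
          linarith [hWj i, hVj i]
end

section
/- There exists a universal constant C > 0 such that for all a₁, a₂ > 0, the function G : (0,∞) → ℝ defined by G(β) = a₁·(exp(β) − β − 1) + a₂/β² satisfies inf_{β>0} G(β) ≤ C·( √(a₁·a₂) + a₂/(log²(a₂/a₁) + 1) ). -/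
/-- There is a universal constant `C > 0` such that for all `a₁, a₂ > 0`,
`inf_{β>0} (a₁(exp β − β − 1) + a₂/β²) ≤ C(√(a₁a₂) + a₂/(log²(a₂/a₁) + 1))`. -/
theorem exp_opt_bound :
    ∃ C : ℝ, 0 < C ∧ ∀ a₁ a₂ : ℝ, 0 < a₁ → 0 < a₂ →
      sInf {v : ℝ | ∃ β > 0, v = a₁ * (Real.exp β - β - 1) + a₂ / β ^ 2} ≤
        C * (Real.sqrt (a₁ * a₂) + a₂ / ((Real.log (a₂ / a₁)) ^ 2 + 1)) := by
  refine ⟨4, by norm_num, fun a₁ a₂ h₁ h₂ => ?_⟩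
  have hbdd : BddBelow {v : ℝ | ∃ β > 0, v = a₁ * (Real.exp β - β - 1) + a₂ / β ^ 2} := by
    refine ⟨0, ?_⟩
    rintro v ⟨β, hβ, rfl⟩
    have : 0 ≤ Real.exp β - β - 1 := by linarith [Real.add_one_le_exp β]
    positivity
  suffices h : ∃ β > 0, a₁ * (Real.exp β - β - 1) + a₂ / β ^ 2 ≤
      4 * (Real.sqrt (a₁ * a₂) + a₂ / ((Real.log (a₂ / a₁)) ^ 2 + 1)) by
    obtain ⟨β, hβ, h⟩ := h
    exact (csInf_le hbdd ⟨β, hβ, rfl⟩).trans h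
  set L := Real.log (a₂ / a₁) with hL
  have hexp : Real.exp L = a₂ / a₁ := Real.exp_log (by positivity)
  have ha₂ : a₂ = a₁ * Real.exp (L / 2) ^ 2 := by
    rw [← Real.exp_nat_mul, show ((2 : ℕ) : ℝ) * (L / 2) = L by push_cast; ring, hexp]
    field_simp
  have hsqrt : Real.sqrt (a₁ * a₂) = a₁ * Real.exp (L / 2) := by
    rw [show a₁ * a₂ = (a₁ * Real.exp (L / 2)) ^ 2 by rw [mul_pow]; nth_rw 1 [ha₂]; ring]
    exact Real.sqrt_sq (by positivity)
  have hfrac : 0 ≤ a₂ / (L ^ 2 + 1) := by positivity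
  have hpos : 0 < a₁ * Real.exp (L / 2) := by positivity
  rw [hsqrt]
  rcases le_total L 0 with hL0 | hL0
  · refine ⟨Real.exp (L / 4), Real.exp_pos _, ?_⟩
    have hβ1 : Real.exp (L / 4) ≤ 1 := Real.exp_le_one_iff.mpr (by linarith)
    have hsq : Real.exp (L / 4) ^ 2 = Real.exp (L / 2) := by
      rw [← Real.exp_nat_mul]
      congr 1
      push_cast
      ring
    have hquad := (le_abs_self _).trans (Real.abs_exp_sub_one_sub_id_le
      (x := Real.exp (L / 4)) (by rwa [abs_of_pos (Real.exp_pos _)]))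
    have hmul : a₁ * (Real.exp (Real.exp (L / 4)) - Real.exp (L / 4) - 1) ≤
        a₁ * Real.exp (L / 2) :=
      mul_le_mul_of_nonneg_left (by linarith) h₁.le
    have hdiv : a₂ / Real.exp (L / 4) ^ 2 = a₁ * Real.exp (L / 2) := by
      rw [hsq, div_eq_iff (Real.exp_pos _).ne']
      nth_rw 1 [ha₂]
      ring
    linarith
  · refine ⟨L / 2 + 1, by positivity, ?_⟩
    have hmul : a₁ * (Real.exp (L / 2 + 1) - (L / 2 + 1) - 1) ≤
        4 * (a₁ * Real.exp (L / 2)) := by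
      have hle : Real.exp (L / 2 + 1) ≤ 4 * Real.exp (L / 2) := by
        rw [Real.exp_add]
        nlinarith [Real.exp_pos (L / 2), Real.exp_one_lt_d9]
      nlinarith
    have hdiv : a₂ / (L / 2 + 1) ^ 2 ≤ 4 * (a₂ / (L ^ 2 + 1)) := by
      rw [← mul_div_assoc, div_le_div_iff₀ (by positivity) (by positivity)]
      nlinarith [mul_nonneg h₂.le hL0]
    linarith
end

section
/- Let σ > 0 and define s_σ : [0,∞) → ℝ by s_σ(t) = (1 − t/σ)² for t < σ and s_σ(t) = 0 for t ≥ σ. Then for all a, b > 0: (s_σ(a + b) − s_σ(a))² ≤ (4/σ²)·s_σ(a)·b². -/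
/-- For all `a, b > 0`, `(s_σ(a+b) - s_σ(a))² ≤ (4/σ²) s_σ(a) b²`. -/
theorem sPen_smooth (σ : ℝ) (hσ : 0 < σ) (a b : ℝ) (ha : 0 < a) (hb : 0 < b) :
    (sPen σ (a + b) - sPen σ a) ^ 2 ≤ (4 / σ ^ 2) * sPen σ a * b ^ 2 := by
  have hv : 0 < b / σ := div_pos hb hσ
  have hrhs : (4 / σ ^ 2) * sPen σ a * b ^ 2 = 4 * sPen σ a * (b / σ) ^ 2 := by ring
  have hab : 1 - (a + b) / σ = (1 - a / σ) - b / σ := by ring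
  rw [hrhs]
  unfold sPen
  rw [hab]
  generalize hu : 1 - a / σ = u
  generalize b / σ = v at *
  split_ifs with h₁ h₂ h₂
  · have huv : 0 < u - v := by
      rw [← hu, ← hab, sub_pos, div_lt_one hσ]
      exact h₁
    have h : (2 * u - v) ^ 2 ≤ (2 * u) ^ 2 := pow_le_pow_left₀ (by linarith) (by linarith) 2
    nlinarith [mul_le_mul_of_nonneg_left h (sq_nonneg v)]
  · linarith
  · have hu₀ : 0 < u := by
      rw [← hu, sub_pos, div_lt_one hσ]
      exact h₂
    have huv : u - v ≤ 0 := by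
      rw [← hu, ← hab, sub_nonpos, one_le_div hσ]
      exact not_lt.mp h₁
    have h : u ^ 2 ≤ v ^ 2 := pow_le_pow_left₀ hu₀.le (by linarith) 2
    nlinarith [mul_le_mul_of_nonneg_left h (sq_nonneg u), mul_nonneg (sq_nonneg u) (sq_nonneg v)]
  · simp
end
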